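/- Let p be a prime and G ⊆ SL(3, F_p) a finite subgroup such that V = (F_p)³ contains two distinct 1-dimensional G-submodules. Then the invariant ring S(V)^G is Gorenstein. -/

import Mathlib

noncomputable section
open CategoryTheory Matrix MvPolynomial

universe u

/-- A module `M` over `R` has finite injective dimension iff the Ext functors
`Ext^i(-, M)` vanish for all sufficiently large `i`. -/
def HasFiniteInjectiveDimension (R : Type u) [CommRing R] (M : ModuleCat.{u} R) : Prop :=
  ∃ n : ℕ, ∀ (N : ModuleCat.{u} R) (i : ℕ), n < i →
    Subsingleton (((Ext R (ModuleCat.{u} R) i).obj (Opposite.op N)).obj M)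

/-- A commutative ring is Gorenstein if it is Noetherian and its localization at every
prime ideal has finite injective dimension over itself. -/
def IsGorensteinRing (R : Type u) [CommRing R] : Prop :=
  IsNoetherianRing R ∧ ∀ (P : Ideal R) [P.IsPrime],
    HasFiniteInjectiveDimension (Localization.AtPrime P)
      (ModuleCat.of (Localization.AtPrime P) (Localization.AtPrime P))

/-- The substitution action of a matrix on polynomials: `X i ↦ ∑ j, M i j • X j`. -/
def polyAct {F : Type u} [CommSemiring F] {m : ℕ} (M : Matrix (Fin m) (Fin m) F) :
    MvPolynomial (Fin m) F →ₐ[F] MvPolynomial (Fin m) F :=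
  MvPolynomial.aeval fun i => ∑ j, M i j • MvPolynomial.X j

/-- The subalgebra of polynomials invariant under a set of matrices. -/
def invariantAlg {F : Type u} [CommSemiring F] {m : ℕ} (S : Set (Matrix (Fin m) (Fin m) F)) :
    Subalgebra F (MvPolynomial (Fin m) F) where
  carrier := {f | ∀ M ∈ S, polyAct M f = f}
  mul_mem' := fun hf hg => fun M hM => by rw [_root_.map_mul, hf M hM, hg M hM]
  add_mem' := fun hf hg => fun M hM => by rw [_root_.map_add, hf M hM, hg M hM]
  algebraMap_mem' := fun r => fun M hM => (polyAct M).commutes r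

/-- The invariant ring `S(V)^G` for a subgroup `G` of `SL(m, F)`, where `S(V)` is realised
as the polynomial ring `F[X 0, …, X (m-1)]`. -/
def invariantRing {F : Type u} [Field F] {m : ℕ}
    (G : Subgroup (Matrix.SpecialLinearGroup (Fin m) F)) :
    Subalgebra F (MvPolynomial (Fin m) F) :=
  invariantAlg {M | ∃ g ∈ G, (g : Matrix (Fin m) (Fin m) F) = M}

/-- A matrix `M` is a transvection if `rank (M - 1) = 1` and `(M - 1)² = 0`. -/
def IsTransvectionMat {F : Type u} [Field F] {m : ℕ} (M : Matrix (Fin m) (Fin m) F) : Prop :=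
  (M - 1).rank = 1 ∧ (M - 1) * (M - 1) = 0

/-- `T(G)`: the subgroup generated by all transvections contained in `G`. -/
def transSubgroup {F : Type u} [Field F] {m : ℕ}
    (G : Subgroup (Matrix.SpecialLinearGroup (Fin m) F)) :
    Subgroup (Matrix.SpecialLinearGroup (Fin m) F) :=
  Subgroup.closure {g | g ∈ G ∧ IsTransvectionMat (g : Matrix (Fin m) (Fin m) F)}

section InjectiveDimension

open CategoryTheory.Limits

lemma exists_d_comp_eq_of_hasInjectiveDimensionLE {C : Type*} [Category* C] [Abelian C]
    [EnoughInjectives C] (P : ChainComplex C ℕ) [∀ i, Projective (P.X i)]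
    (hP : ∀ i, P.ExactAt (i + 1)) (n : ℕ) (M : C) [HasInjectiveDimensionLE M n] (k : ℕ)
    (hk : n ≤ k) (f : P.X (k + 1) ⟶ M) (hf : P.d (k + 2) (k + 1) ≫ f = 0) :
    ∃ g : P.X k ⟶ M, P.d (k + 1) k ≫ g = f := by
  have key : ∀ (I : C) [Injective I] (j : ℕ) (f : P.X (j + 1) ⟶ I),
      P.d (j + 2) (j + 1) ≫ f = 0 → ∃ g : P.X j ⟶ I, P.d (j + 1) j ≫ g = f := by
    intro I _ j f hf
    have hex : (P.sc' (j + 2) (j + 1) j).Exact :=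
      (P.exactAt_iff' _ _ _ (by simp) (by simp)).1 (hP j)
    exact ⟨hex.descToInjective f hf, hex.comp_descToInjective f hf⟩
  induction n generalizing M k with
  | zero =>
    have : Injective M := injective_iff_hasInjectiveDimensionLT_one.2 ‹_›
    exact key M k f hf
  | succ n ih =>
    obtain ⟨k, rfl⟩ : ∃ l, k = l + 1 := ⟨k - 1, by omega⟩
    obtain ⟨I, _, ι, _⟩ := EnoughInjectives.presentation M
    let S := ShortComplex.mk ι (cokernel.π ι) (cokernel.condition ι)
    have hS : S.ShortExact := { exact := ShortComplex.exact_cokernel ι }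
    have : HasInjectiveDimensionLE S.X₃ n := (hS.hasInjectiveDimensionLT_X₃_iff n ‹_›).2 ‹_›
    obtain ⟨g, hg⟩ := key I (k + 1) (f ≫ ι) (by rw [← Category.assoc, hf, zero_comp])
    obtain ⟨h, hh⟩ := ih S.X₃ k (by omega) (g ≫ cokernel.π ι) (by
      rw [← Category.assoc, hg, Category.assoc, cokernel.condition, comp_zero])
    have hg' : (g - P.d (k + 1) k ≫ Projective.factorThru h (cokernel.π ι)) ≫ S.g = 0 := by
      have : Projective.factorThru h (cokernel.π ι) ≫ cokernel.π ι = h :=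
        Projective.factorThru_comp _ _
      simp only [S, Preadditive.sub_comp, Category.assoc, this, hh, sub_self]
    refine ⟨hS.exact.lift _ hg', ?_⟩
    have : Mono S.f := hS.mono_f
    rw [← cancel_mono S.f, Category.assoc, hS.exact.lift_f]
    simp [Preadditive.comp_sub, hg, S]

theorem hasFiniteInjectiveDimension_of_hasInjectiveDimensionLE {R : Type u} [CommRing R]
    (M : ModuleCat.{u} R) (n : ℕ) [HasInjectiveDimensionLE M n] :
    HasFiniteInjectiveDimension R M := by
  refine ⟨n, fun N i hi ↦ ?_⟩
  obtain ⟨k, rfl⟩ : ∃ l, i = l + 1 := ⟨i - 1, by omega⟩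
  let P := projectiveResolution N
  have hz : IsZero (((Ext R (ModuleCat.{u} R) (k + 1)).obj (Opposite.op N)).obj M) := by
    refine IsZero.of_iso ?_ (P.isoExt (k + 1) M)
    rw [← HomologicalComplex.exactAt_iff_isZero_homology,
      HomologicalComplex.exactAt_iff' _ k (k + 1) (k + 2) (by simp) (by simp),
      ShortComplex.moduleCat_exact_iff]
    intro (f : P.complex.X (k + 1) ⟶ M) (hf : P.complex.d (k + 2) (k + 1) ≫ f = 0)
    exact exists_d_comp_eq_of_hasInjectiveDimensionLE P.complex P.complex_exactAt_succ n M k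
      (by omega) f hf
  exact ModuleCat.subsingleton_of_isZero hz

lemma hasInjectiveDimensionLE_obj {C D : Type*} [Category* C] [Category* D] [Abelian C]
    [Abelian D] [EnoughInjectives C] (F : C ⥤ D) [F.Additive] [F.PreservesInjectiveObjects]
    [PreservesFiniteLimits F] [F.PreservesEpimorphisms] (X : C) (n : ℕ)
    [HasInjectiveDimensionLE X n] : HasInjectiveDimensionLE (F.obj X) n := by
  induction n generalizing X with
  | zero =>
    have : Injective X := injective_iff_hasInjectiveDimensionLT_one.2 ‹_›
    exact injective_iff_hasInjectiveDimensionLT_one.1 inferInstance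
  | succ n ih =>
    obtain ⟨I, _, ι, _⟩ := EnoughInjectives.presentation X
    let S := ShortComplex.mk ι (cokernel.π ι) (cokernel.condition ι)
    have hS : S.ShortExact := { exact := ShortComplex.exact_cokernel ι }
    have hFS : (S.map F).ShortExact :=
      { exact := hS.exact.map_of_mono_of_preservesKernel F hS.mono_f inferInstance
        mono_f := inferInstanceAs (Mono (F.map ι))
        epi_g := inferInstanceAs (Epi (F.map (cokernel.π ι))) }
    have : HasInjectiveDimensionLE S.X₃ n := (hS.hasInjectiveDimensionLT_X₃_iff n ‹_›).2 ‹_›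
    exact (hFS.hasInjectiveDimensionLT_X₃_iff n (inferInstanceAs (Injective (F.obj I)))).1
      (ih S.X₃)

lemma hasInjectiveDimensionLE_coextendScalars {A R : Type u} [CommRing A] [CommRing R]
    [Algebra A R] [Module.Projective A R] (M : ModuleCat.{u} A) (n : ℕ)
    [HasInjectiveDimensionLE M n] :
    HasInjectiveDimensionLE ((ModuleCat.coextendScalars.{u, u, u} (algebraMap A R)).obj M) n := by
  let F := ModuleCat.coextendScalars.{u, u, u} (algebraMap A R)
  let adj := ModuleCat.restrictCoextendScalarsAdj.{u, u, u} (algebraMap A R)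
  have : PreservesLimits F := adj.rightAdjoint_preservesLimits
  have : F.Additive := adj.right_adjoint_additive
  have : F.PreservesInjectiveObjects :=
    Functor.preservesInjectiveObjects_of_adjunction_of_preservesMonomorphisms adj
  have : F.PreservesEpimorphisms := by
    refine ⟨fun {X Y} f hf ↦ ?_⟩
    rw [ModuleCat.epi_iff_surjective] at hf ⊢
    intro (h : (ModuleCat.restrictScalars (algebraMap A R)).obj (ModuleCat.of R R) →ₗ[A] Y)
    have : Module.Projective A
        ((ModuleCat.restrictScalars (algebraMap A R)).obj (ModuleCat.of R R)) :=
      let e : R ≃ₗ[A] ((ModuleCat.restrictScalars (algebraMap A R)).obj (ModuleCat.of R R)) :=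
        { (AddEquiv.refl R : R ≃+ ((ModuleCat.restrictScalars (algebraMap A R)).obj
            (ModuleCat.of R R))) with
          map_smul' := fun a r ↦ Algebra.smul_def a r }
      Module.Projective.of_equiv e
    obtain ⟨g, hg⟩ := Module.projective_lifting_property f.hom h hf
    exact ⟨g, hg⟩
  exact hasInjectiveDimensionLE_obj F M n

end InjectiveDimension

section GlobalDimension

open ModuleCat

/-- The endomorphism `φ ↦ (s ↦ r • φ s - φ (s * r))` of the coinduced module `Hom_A(B, M)`. -/
def coextendScalarsCommutator {A B : Type u} [CommRing A] [CommRing B] (f : A →+* B) (r : B)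
    (M : ModuleCat.{u} B) :
    (coextendScalars.{u, u, u} f).obj ((restrictScalars.{u} f).obj M) →ₗ[B]
      (coextendScalars.{u, u, u} f).obj ((restrictScalars.{u} f).obj M) where
  toFun φ := (CoextendScalars.equiv f _).symm
    (((restrictScalars.{u} f).map (ofHom (r • LinearMap.id : M →ₗ[B] M))).hom ∘ₗ
        CoextendScalars.equiv f _ φ -
      CoextendScalars.equiv f _ φ ∘ₗ ((restrictScalars.{u} f).map
        (ofHom (r • LinearMap.id : ModuleCat.of B B →ₗ[B] ModuleCat.of B B))).hom)
  map_add' φ ψ := by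
    rw [← map_add, map_add, LinearMap.comp_add, LinearMap.add_comp, add_sub_add_comm]
  map_smul' s φ := by
    refine CoextendScalars.ext (LinearMap.ext fun (x : B) ↦ ?_)
    change (r • φ (x * s : B) - φ ((r • x) * s : B) : M) = (r • φ (x * s) - φ (r • (x * s)) : M)
    rw [smul_mul_assoc]

lemma coextendScalarsCommutator_apply {A B : Type u} [CommRing A] [CommRing B] (f : A →+* B)
    (r : B) (M : ModuleCat.{u} B)
    (φ : (coextendScalars.{u, u, u} f).obj ((restrictScalars.{u} f).obj M)) (s : B) :
    (coextendScalarsCommutator f r M φ s : M) = (r • (φ s : M) - (φ (r * s : B) : M) : M) :=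
  rfl

/-- The unit `y ↦ (s ↦ s • y)` of the restriction-coinduction adjunction. -/
abbrev coextendScalarsUnit {A B : Type u} [CommRing A] [CommRing B] (f : A →+* B)
    (M : ModuleCat.{u} B) :
    M →ₗ[B] (coextendScalars.{u, u, u} f).obj ((restrictScalars.{u} f).obj M) :=
  RestrictionCoextensionAdj.app' f M

open scoped Polynomial in
/-- The `A`-linear map `A[X] → M` with prescribed values on powers of `X`. -/
def coextendScalarsMk {A : Type u} [CommRing A] (M : ModuleCat.{u} A[X]) (a : ℕ → M) :
    (coextendScalars.{u, u, u} (algebraMap A A[X])).obj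
      ((restrictScalars.{u} (algebraMap A A[X])).obj M) :=
  let : Module A M := Module.compHom M (algebraMap A A[X])
  let L : A[X] →ₗ[A] M := (Polynomial.basisMonomials A).constr ℕ a
  (CoextendScalars.equiv (algebraMap A A[X]) _).symm
    { toFun := fun s ↦ L (s : A[X])
      map_add' := fun s t ↦ L.map_add (s : A[X]) t
      map_smul' := fun c s ↦ (congrArg L (@Algebra.smul_def A A[X] _ _ _ c s).symm).trans
        (L.map_smul c (s : A[X])) }

open scoped Polynomial in
lemma coextendScalarsMk_apply {A : Type u} [CommRing A] (M : ModuleCat.{u} A[X]) (a : ℕ → M)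
    (i : ℕ) : (coextendScalarsMk M a (Polynomial.X ^ i : A[X]) : M) = a i := by
  let : Module A M := Module.compHom M (algebraMap A A[X])
  change (Polynomial.basisMonomials A).constr ℕ a (Polynomial.X ^ i : A[X]) = a i
  have h := Module.Basis.constr_basis (Polynomial.basisMonomials A) ℕ a i
  rw [Polynomial.coe_basisMonomials] at h
  dsimp only at h
  rwa [Polynomial.monomial_one_right_eq_X_pow] at h

open scoped Polynomial in
lemma coextendScalars_ext {A : Type u} [CommRing A] (M : ModuleCat.{u} A[X])
    (φ ψ : (coextendScalars.{u, u, u} (algebraMap A A[X])).obj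
      ((restrictScalars.{u} (algebraMap A A[X])).obj M))
    (h : ∀ i : ℕ, (φ (Polynomial.X ^ i : A[X]) : M) = (ψ (Polynomial.X ^ i : A[X]) : M)) :
    φ = ψ := by
  let : Module A M := Module.compHom M (algebraMap A A[X])
  have key : ∀ φ : (coextendScalars.{u, u, u} (algebraMap A A[X])).obj
      ((restrictScalars.{u} (algebraMap A A[X])).obj M),
      ∃ L : A[X] →ₗ[A] M, ∀ s : A[X], L s = (φ s : M) := fun φ ↦
    ⟨{  toFun := fun s ↦ (φ s : M)
        map_add' := fun s t ↦ (CoextendScalars.equiv (algebraMap A A[X]) _ φ).map_add s t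
        map_smul' := fun c s ↦ (congrArg (fun t : A[X] ↦ (φ t : M)) (Algebra.smul_def c s)).trans
          ((CoextendScalars.equiv (algebraMap A A[X]) _ φ).map_smul c s) }, fun _ ↦ rfl⟩
  obtain ⟨L, hL⟩ := key φ
  obtain ⟨L', hL'⟩ := key ψ
  have : L = L' := (Polynomial.basisMonomials A).ext fun i ↦ by
    rw [Polynomial.coe_basisMonomials]
    dsimp only
    rw [Polynomial.monomial_one_right_eq_X_pow, hL, hL', h]
  exact CoextendScalars.ext (LinearMap.ext fun s ↦ by
    exact (hL s).symm.trans ((congrArg (fun l : A[X] →ₗ[A] M ↦ l s) this).trans (hL' s)))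

open scoped Polynomial in
lemma coextendScalars_shortExact {A : Type u} [CommRing A] (M : ModuleCat.{u} A[X]) :
    ∃ S : ShortComplex (ModuleCat.{u} A[X]), S.ShortExact ∧ S.X₁ = M ∧
      S.X₂ = (coextendScalars.{u, u, u} (algebraMap A A[X])).obj
        ((restrictScalars.{u} (algebraMap A A[X])).obj M) ∧
      S.X₃ = (coextendScalars.{u, u, u} (algebraMap A A[X])).obj
        ((restrictScalars.{u} (algebraMap A A[X])).obj M) := by
  let u := coextendScalarsUnit (algebraMap A A[X]) M
  let v := coextendScalarsCommutator (algebraMap A A[X]) Polynomial.X M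
  have hexact : Function.Exact u v := by
    intro φ
    constructor
    · intro h
      refine ⟨φ (1 : A[X]), coextendScalars_ext _ _ _ fun i ↦ ?_⟩
      change ((Polynomial.X : A[X]) ^ i • (show M from φ (1 : A[X])) : M) =
        (show M from φ (Polynomial.X ^ i : A[X]))
      induction i with
      | zero => rw [pow_zero, one_smul]
      | succ i ih =>
        have h' : (Polynomial.X : A[X]) • (φ (Polynomial.X ^ i : A[X]) : M) -
            (φ (Polynomial.X * Polynomial.X ^ i : A[X]) : M) = (0 : M) := by
          rw [← coextendScalarsCommutator_apply]
          exact congrArg (fun ψ : (coextendScalars.{u, u, u} (algebraMap A A[X])).obj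
            ((restrictScalars.{u} (algebraMap A A[X])).obj M) ↦ (ψ (Polynomial.X ^ i : A[X]) : M)) h
        rw [pow_succ', mul_smul, ih]
        exact sub_eq_zero.1 h'
    · rintro ⟨y, rfl⟩
      refine coextendScalars_ext _ _ _ fun i ↦ ?_
      change ((Polynomial.X : A[X]) • ((Polynomial.X : A[X]) ^ i • y) -
        (Polynomial.X * Polynomial.X ^ i : A[X]) • y : M) = (0 : M)
      rw [mul_smul, sub_self]
  have hinj : Function.Injective u := by
    intro y z h
    have : ((1 : A[X]) • y : M) = (1 : A[X]) • z :=
      congrArg (fun ψ : (coextendScalars.{u, u, u} (algebraMap A A[X])).obj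
        ((restrictScalars.{u} (algebraMap A A[X])).obj M) ↦ (ψ (1 : A[X]) : M)) h
    simpa using this
  have hsurj : Function.Surjective v := by
    intro ψ
    let a : ℕ → M := fun n ↦ Nat.rec (motive := fun _ ↦ M) 0
      (fun i m ↦ ((Polynomial.X : A[X]) • m - (show M from ψ (Polynomial.X ^ i : A[X])) : M)) n
    refine ⟨coextendScalarsMk M a, coextendScalars_ext _ _ _ fun i ↦ ?_⟩
    change (coextendScalarsCommutator (algebraMap A A[X]) Polynomial.X M (coextendScalarsMk M a)
      (Polynomial.X ^ i : A[X]) : M) = _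
    rw [coextendScalarsCommutator_apply, coextendScalarsMk_apply, ← pow_succ',
      coextendScalarsMk_apply]
    exact sub_sub_cancel _ _
  let S : ShortComplex (ModuleCat.{u} A[X]) :=
    ModuleCat.shortComplexOfCompEqZero u v hexact.linearMap_comp_eq_zero
  exact ⟨S, ModuleCat.shortComplex_shortExact S hexact hinj hsurj, rfl, rfl, rfl⟩

open scoped Polynomial in
lemma hasInjectiveDimensionLE_polynomial {A : Type u} [CommRing A] (n : ℕ)
    (hA : ∀ M : ModuleCat.{u} A, HasInjectiveDimensionLE M n) (M : ModuleCat.{u} A[X]) :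
    HasInjectiveDimensionLE M (n + 1) := by
  obtain ⟨S, hS, h₁, h₂, h₃⟩ := coextendScalars_shortExact M
  have := hA ((restrictScalars.{u} (algebraMap A A[X])).obj M)
  have hc := hasInjectiveDimensionLE_coextendScalars (R := A[X])
    ((restrictScalars.{u} (algebraMap A A[X])).obj M) n
  rw [← h₁]
  refine hS.hasInjectiveDimensionLT_X₁ (n + 1) (by rw [h₃]; exact hc) ?_
  rw [h₂]
  exact hasInjectiveDimensionLT_of_ge _ (n + 1) _ (by omega)

attribute [local instance] RingHomInvPair.of_ringEquiv in
lemma hasInjectiveDimensionLE_of_ringEquiv {A B : Type u} [CommRing A] [CommRing B]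
    (e : A ≃+* B) (n : ℕ) (hA : ∀ M : ModuleCat.{u} A, HasInjectiveDimensionLE M n)
    (M : ModuleCat.{u} B) : HasInjectiveDimensionLE M n := by
  let M' : ModuleCat.{u} A := (restrictScalars.{u} e.toRingHom).obj M
  let e' : M' ≃ₛₗ[RingHomClass.toRingHom e] M :=
    { AddEquiv.refl M with map_smul' := fun _ _ ↦ rfl }
  exact (hasInjectiveDimensionLE_iff_of_semiLinearEquiv e e' n).1 (hA M')

lemma hasInjectiveDimensionLE_mvPolynomial_fin (F : Type u) [Field F] (n : ℕ)
    (M : ModuleCat.{u} (MvPolynomial (Fin n) F)) : HasInjectiveDimensionLE M n := by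
  induction n with
  | zero =>
    refine hasInjectiveDimensionLE_of_ringEquiv
      (MvPolynomial.isEmptyRingEquiv F (Fin 0)).symm 0 (fun N ↦ ?_) M
    have : Module.Injective F N := Module.injective_of_isSemisimpleRing F N
    exact injective_iff_hasInjectiveDimensionLT_one.1
      (Module.injective_object_of_injective_module F N)
  | succ n ih =>
    exact hasInjectiveDimensionLE_of_ringEquiv
      (MvPolynomial.finSuccEquiv F n).toRingEquiv.symm (n + 1)
      (hasInjectiveDimensionLE_polynomial n ih) M

end GlobalDimension

section Gorenstein

open ModuleCat

lemma hasInjectiveDimensionLE_of_isLocalizedModule {R : Type u} [CommRing R]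
    [IsNoetherianRing R] (S : Submonoid R) (M : ModuleCat.{u} R)
    (N : ModuleCat.{u} (Localization S)) [Module R N] [IsScalarTower R (Localization S) N]
    (f : M →ₗ[R] N) [IsLocalizedModule S f] (n : ℕ) [HasInjectiveDimensionLE M n] :
    HasInjectiveDimensionLE N n := by
  have := M.localizedModule_hasInjectiveDimensionLE n S
  let e : M.localizedModule S ≃ₗ[Localization S] N :=
    LinearEquiv.extendScalarsOfIsLocalization S (Localization S)
      (IsLocalizedModule.linearEquiv S (M.localizedModuleMkLinearMap S) f)
  exact hasInjectiveDimensionLT_of_iso e.toModuleIso (n + 1)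

theorem isGorensteinRing_of_hasInjectiveDimensionLE (R : Type u) [CommRing R]
    [IsNoetherianRing R] (n : ℕ) (h : HasInjectiveDimensionLE (ModuleCat.of R R) n) :
    IsGorensteinRing R := by
  refine ⟨inferInstance, fun P _ ↦ ?_⟩
  have : HasInjectiveDimensionLE
      (ModuleCat.of (Localization.AtPrime P) (Localization.AtPrime P)) n :=
    hasInjectiveDimensionLE_of_isLocalizedModule P.primeCompl (ModuleCat.of R R)
      (ModuleCat.of (Localization P.primeCompl) (Localization P.primeCompl))
      (Algebra.linearMap R (Localization P.primeCompl)) n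
  exact hasFiniteInjectiveDimension_of_hasInjectiveDimensionLE _ n

attribute [local instance] RingHomInvPair.of_ringEquiv in
lemma hasInjectiveDimensionLE_self_of_ringEquiv {R R' : Type u} [CommRing R] [CommRing R']
    (e : R ≃+* R') (n : ℕ) (h : HasInjectiveDimensionLE (ModuleCat.of R R) n) :
    HasInjectiveDimensionLE (ModuleCat.of R' R') n := by
  let e' : ModuleCat.of R R ≃ₛₗ[RingHomClass.toRingHom e] ModuleCat.of R' R' :=
    { e.toAddEquiv with map_smul' := fun a b ↦ map_mul e a b }
  exact (hasInjectiveDimensionLE_iff_of_semiLinearEquiv e e' n).1 h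

/-- An algebra with a nondegenerate trace-like form and a pair of dual families. -/
structure IsDualPair {A R ι : Type*} [CommRing A] [CommRing R] [Algebra A R] [Fintype ι]
    [DecidableEq ι] (τ : R →ₗ[A] A) (b b' : ι → R) : Prop where
  apply_mul : ∀ i j, τ (b i * b' j) = if i = j then 1 else 0
  sum_smul : ∀ r, ∑ j, τ (r * b' j) • b j = r

lemma IsDualPair.linearIndependent {A R ι : Type*} [CommRing A] [CommRing R] [Algebra A R]
    [Fintype ι] [DecidableEq ι] {τ : R →ₗ[A] A} {b b' : ι → R} (h : IsDualPair τ b b') :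
    LinearIndependent A b := by
  rw [Fintype.linearIndependent_iff]
  intro g hg i
  have : τ ((∑ j, g j • b j) * b' i) = g i := by
    simp [Finset.sum_mul, h.apply_mul]
  rw [← this, hg, zero_mul, map_zero]

lemma IsDualPair.span_eq_top {A R ι : Type*} [CommRing A] [CommRing R] [Algebra A R]
    [Fintype ι] [DecidableEq ι] {τ : R →ₗ[A] A} {b b' : ι → R} (h : IsDualPair τ b b') :
    ⊤ ≤ Submodule.span A (Set.range b) := fun r _ ↦ by
  rw [← h.sum_smul r]
  exact Submodule.sum_mem _ fun j _ ↦ Submodule.smul_mem _ _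
    (Submodule.subset_span (Set.mem_range_self j))

/-- The basis underlying a dual pair. -/
def IsDualPair.basis {A R ι : Type*} [CommRing A] [CommRing R] [Algebra A R]
    [Fintype ι] [DecidableEq ι] {τ : R →ₗ[A] A} {b b' : ι → R} (h : IsDualPair τ b b') :
    Module.Basis ι A R :=
  Module.Basis.mk h.linearIndependent h.span_eq_top

lemma IsDualPair.hasInjectiveDimensionLE {A R : Type u} {ι : Type*} [CommRing A] [CommRing R]
    [Algebra A R] [Fintype ι] [DecidableEq ι] {τ : R →ₗ[A] A} {b b' : ι → R}
    (h : IsDualPair τ b b') (n : ℕ) (hA : HasInjectiveDimensionLE (ModuleCat.of A A) n) :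
    HasInjectiveDimensionLE (ModuleCat.of R R) n := by
  have : Module.Free A R := .of_basis h.basis
  have hc := hasInjectiveDimensionLE_coextendScalars (R := R) (ModuleCat.of A A) n
  let N := (coextendScalars.{u, u, u} (algebraMap A R)).obj (ModuleCat.of A A)
  let Θ : R →ₗ[R] N :=
    { toFun := fun r ↦ (CoextendScalars.equiv (algebraMap A R) _).symm
        { toFun := fun s ↦ (τ ∘ₗ LinearMap.mulRight A r) s
          map_add' := fun s t ↦ (τ ∘ₗ LinearMap.mulRight A r).map_add s t
          map_smul' := fun c s ↦ (congrArg (τ ∘ₗ LinearMap.mulRight A r)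
            (@Algebra.smul_def A R _ _ _ c s).symm).trans
              ((τ ∘ₗ LinearMap.mulRight A r).map_smul c s) }
      map_add' := fun r r' ↦ CoextendScalars.ext (LinearMap.ext fun (s : R) ↦
        (congrArg τ (mul_add s r r')).trans (map_add τ _ _))
      map_smul' := fun c r ↦ CoextendScalars.ext (LinearMap.ext fun (s : R) ↦
        congrArg τ (mul_assoc s c r).symm) }
  have hΘ : ∀ r s : R, (Θ r s : A) = τ (s * r) := fun _ _ ↦ rfl
  have hinj : Function.Injective Θ := by
    intro r r' hr
    rw [← h.sum_smul r, ← h.sum_smul r']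
    refine Finset.sum_congr rfl fun j _ ↦ ?_
    have : (Θ r (b' j) : A) = Θ r' (b' j) := by rw [hr]
    rw [hΘ, hΘ] at this
    rw [mul_comm r, mul_comm r', this]
  have hsurj : Function.Surjective Θ := by
    intro φ
    let L : R →ₗ[A] A :=
      { toFun := fun s ↦ φ s
        map_add' := fun s t ↦ (CoextendScalars.equiv (algebraMap A R) _ φ).map_add s t
        map_smul' := fun c s ↦ (congrArg (fun t : R ↦ (φ t : A)) (Algebra.smul_def c s)).trans
          ((CoextendScalars.equiv (algebraMap A R) _ φ).map_smul c s) }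
    refine ⟨∑ j, L (b j) • b' j, CoextendScalars.ext (LinearMap.ext fun (s : R) ↦ ?_)⟩
    change τ (s * ∑ j, L (b j) • b' j) = L s
    conv_rhs => rw [← h.sum_smul s]
    simp [Finset.mul_sum, mul_comm]
  exact hasInjectiveDimensionLT_of_iso
    (LinearEquiv.ofBijective Θ ⟨hinj, hsurj⟩).symm.toModuleIso (n + 1)

theorem IsDualPair.isNoetherianRing {A R : Type*} {ι : Type*} [CommRing A] [CommRing R]
    [Algebra A R] [Fintype ι] [DecidableEq ι] {τ : R →ₗ[A] A} {b b' : ι → R}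
    (h : IsDualPair τ b b') [IsNoetherianRing A] : IsNoetherianRing R :=
  have : Module.Finite A R := .of_basis h.basis
  IsNoetherianRing.of_finite A R

end Gorenstein

section DiagonalInvariants

variable {F : Type u} [Field F] {m : ℕ}

/-- The map sending a monomial `X ^ (n • k + (n - 1))` to `X ^ k` and all other monomials to `0`;
it generates the dual of `F[X]` as a module over the ring of `n`-expansions. -/
def expandTrace (F : Type u) [Field F] (m n : ℕ) :
    MvPolynomial (Fin m) F →ₗ[F] MvPolynomial (Fin m) F :=
  (basisMonomials (Fin m) F).constr F fun e ↦
    if ∀ i, n ∣ e i + 1 then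
      monomial (Finsupp.equivFunOnFinite.symm fun i ↦ (e i + 1) / n - 1) 1 else 0

lemma expandTrace_monomial (n : ℕ) (e : Fin m →₀ ℕ) (c : F) :
    expandTrace F m n (monomial e c) = if ∀ i, n ∣ e i + 1 then
      monomial (Finsupp.equivFunOnFinite.symm fun i ↦ (e i + 1) / n - 1) c else 0 := by
  have h := (basisMonomials (Fin m) F).constr_basis F (fun e ↦
    if ∀ i, n ∣ e i + 1 then
      (monomial (Finsupp.equivFunOnFinite.symm fun i ↦ (e i + 1) / n - 1) 1 :
        MvPolynomial (Fin m) F) else 0) e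
  rw [coe_basisMonomials] at h
  have hc : (monomial e c : MvPolynomial (Fin m) F) = c • monomial e 1 := by
    rw [smul_monomial, smul_eq_mul, mul_one]
  rw [hc, map_smul]
  refine (congrArg (c • ·) h).trans ?_
  split_ifs
  · rw [smul_monomial, smul_eq_mul, mul_one]
  · rw [smul_zero]

lemma expandTrace_expand_mul {n : ℕ} (hn : n ≠ 0) (a r : MvPolynomial (Fin m) F) :
    expandTrace F m n (expand n a * r) = a * expandTrace F m n r := by
  induction a using MvPolynomial.induction_on' with
  | add a b ha hb => simp only [map_add, add_mul, ha, hb]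
  | monomial a c =>
    induction r using MvPolynomial.induction_on' with
    | add r s hr hs => simp only [map_add, mul_add, hr, hs]
    | monomial e d =>
      have key : ∀ i, (n * a i + e i + 1) = n * a i + (e i + 1) := fun i ↦ by ring
      simp only [expand_monomial, monomial_mul, expandTrace_monomial,
        Finsupp.coe_add, Finsupp.coe_smul, Pi.add_apply, Pi.smul_apply, smul_eq_mul, key,
        Nat.dvd_add_right (Dvd.intro _ rfl)]
      split_ifs with h
      · rw [monomial_mul]
        congr 2
        ext i
        have hi := Nat.le_of_dvd (Nat.succ_pos _) (h i)
        have : 1 ≤ (e i + 1) / n := (Nat.one_le_div_iff (Nat.pos_of_ne_zero hn)).2 hi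
        simp only [Finsupp.equivFunOnFinite_symm_apply_apply, Finsupp.coe_add, Pi.add_apply,
          Nat.mul_add_div (Nat.pos_of_ne_zero hn)]
        omega
      · rw [mul_zero]

lemma polyAct_diagonal_monomial (d : Fin m → F) (e : Fin m →₀ ℕ) (c : F) :
    polyAct (Matrix.diagonal d) (monomial e c) = monomial e ((∏ i, d i ^ e i) * c) := by
  rw [polyAct, aeval_monomial, monomial_eq, Finsupp.prod_fintype _ _ (by simp),
    Finsupp.prod_fintype _ _ (by simp)]
  simp only [Matrix.diagonal_apply, ite_smul, zero_smul, Finset.sum_ite_eq, Finset.mem_univ,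
    if_true, smul_pow, Finset.prod_smul, algebraMap_eq]
  rw [mul_comm (∏ i, d i ^ e i), C_mul, mul_assoc, smul_eq_C_mul]

lemma coeff_polyAct_diagonal (d : Fin m → F) (e : Fin m →₀ ℕ) (f : MvPolynomial (Fin m) F) :
    coeff e (polyAct (Matrix.diagonal d) f) = (∏ i, d i ^ e i) * coeff e f := by
  induction f using MvPolynomial.induction_on' with
  | add f g hf hg => simp only [map_add, coeff_add, hf, hg, mul_add]
  | monomial a c =>
    rw [polyAct_diagonal_monomial, coeff_monomial, coeff_monomial]
    split_ifs with h
    · rw [h]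
    · rw [mul_zero]

variable (K : Set (Fin m → F))

lemma monomial_mem_invariantAlg_diagonal {e : Fin m →₀ ℕ}
    (he : ∀ d ∈ K, ∏ i, d i ^ e i = 1) (c : F) :
    monomial e c ∈ invariantAlg (Matrix.diagonal '' K) := by
  rintro _ ⟨d, hd, rfl⟩
  rw [polyAct_diagonal_monomial, he d hd, one_mul]

lemma prod_pow_eq_one_of_mem_support {f : MvPolynomial (Fin m) F}
    (hf : f ∈ invariantAlg (Matrix.diagonal '' K)) {e : Fin m →₀ ℕ} (he : e ∈ f.support)
    {d : Fin m → F} (hd : d ∈ K) : ∏ i, d i ^ e i = 1 := by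
  have h := coeff_polyAct_diagonal d e f
  rw [hf _ ⟨d, hd, rfl⟩] at h
  exact mul_right_cancel₀ (mem_support_iff.1 he) (by rw [one_mul, ← h])

lemma expand_mem_invariantAlg_diagonal {n : ℕ} (hK : ∀ d ∈ K, ∀ i, d i ^ n = 1)
    (a : MvPolynomial (Fin m) F) : expand n a ∈ invariantAlg (Matrix.diagonal '' K) := by
  induction a using MvPolynomial.induction_on' with
  | add f g hf hg => rw [map_add]; exact add_mem hf hg
  | monomial e c =>
    rw [expand_monomial]
    refine monomial_mem_invariantAlg_diagonal K (fun d hd ↦ ?_) c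
    simp [pow_mul, hK d hd]

/-- The structure map of the ring of diagonal invariants over the ring of `n`-expansions. -/
def expandHom {n : ℕ} (hK : ∀ d ∈ K, ∀ i, d i ^ n = 1) :
    MvPolynomial (Fin m) F →ₐ[F] invariantAlg (Matrix.diagonal '' K) :=
  (expand n).codRestrict _ (expand_mem_invariantAlg_diagonal K hK)

lemma dvd_add_sub_iff_eq_mod {n j : ℕ} (e : ℕ) (hj : j < n) :
    n ∣ e + (n - 1 - j) + 1 ↔ j = e % n := by
  have h : e + (n - 1 - j) + 1 = n * (e / n) + (e % n + (n - j)) := by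
    have := Nat.div_add_mod e n
    omega
  have hr := Nat.mod_lt e (by omega : n > 0)
  rw [h, Nat.dvd_add_right (Dvd.intro _ rfl)]
  constructor
  · rintro ⟨k, hk⟩
    have h₁ : k < 2 := by
      by_contra! hk₂
      have := Nat.mul_le_mul_left n hk₂
      omega
    interval_cases k <;> omega
  · intro hj
    exact ⟨1, by omega⟩

theorem exists_isDualPair_diagonal {n : ℕ} (hn : n ≠ 0) (hK : ∀ d ∈ K, ∀ i, d i ^ n = 1)
    (hK₁ : ∀ d ∈ K, ∏ i, d i = 1) :
    letI := (expandHom K hK).toRingHom.toAlgebra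
    ∃ (ι : Type) (_ : Fintype ι) (_ : DecidableEq ι)
      (τ : invariantAlg (Matrix.diagonal '' K) →ₗ[MvPolynomial (Fin m) F]
        MvPolynomial (Fin m) F) (b b' : ι → invariantAlg (Matrix.diagonal '' K)),
      IsDualPair τ b b' := by
  classical
  let := (expandHom K hK).toRingHom.toAlgebra
  let ι := {j : Fin m → Fin n // ∀ d ∈ K, ∏ i, d i ^ (j i : ℕ) = 1}
  let E : (Fin m → Fin n) → (Fin m →₀ ℕ) := fun j ↦ Finsupp.equivFunOnFinite.symm fun i ↦ j i
  let E' : (Fin m → Fin n) → (Fin m →₀ ℕ) :=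
    fun j ↦ Finsupp.equivFunOnFinite.symm fun i ↦ n - 1 - j i
  have hE : ∀ j i, E j i = j i := fun _ _ ↦ rfl
  have hE' : ∀ j i, E' j i = n - 1 - j i := fun _ _ ↦ rfl
  let τ : invariantAlg (Matrix.diagonal '' K) →ₗ[MvPolynomial (Fin m) F]
      MvPolynomial (Fin m) F :=
    { toFun := fun r ↦ expandTrace F m n r
      map_add' := fun r s ↦ map_add _ (r : MvPolynomial (Fin m) F) s
      map_smul' := fun a r ↦ expandTrace_expand_mul hn a r }
  have hb' : ∀ j : ι, ∀ d ∈ K, ∏ i, d i ^ E' j.1 i = 1 := by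
    rintro ⟨j, hj⟩ d hd
    calc ∏ i, d i ^ E' j i = (∏ i, d i ^ E' j i) * ∏ i, d i ^ (j i : ℕ) := by
          rw [hj d hd, mul_one]
      _ = ∏ i, d i ^ (n - 1) := by
          rw [← Finset.prod_mul_distrib]
          refine Finset.prod_congr rfl fun i _ ↦ ?_
          rw [← pow_add, hE', Nat.sub_add_cancel (by have := (j i).2; omega)]
      _ = 1 := by rw [Finset.prod_pow, hK₁ d hd, one_pow]
  let b : ι → invariantAlg (Matrix.diagonal '' K) :=
    fun j ↦ ⟨monomial (E j.1) 1, monomial_mem_invariantAlg_diagonal K j.2 1⟩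
  let b' : ι → invariantAlg (Matrix.diagonal '' K) :=
    fun j ↦ ⟨monomial (E' j.1) 1, monomial_mem_invariantAlg_diagonal K (hb' j) 1⟩
  have hτ : ∀ (e : Fin m →₀ ℕ) (c : F) (j : ι),
      expand n (expandTrace F m n (monomial e c * monomial (E' j.1) 1)) * monomial (E j.1) 1 =
        if ∀ i, (j.1 i : ℕ) = e i % n then monomial e c else 0 := by
    intro e c j
    have key : ∀ i, n ∣ e i + (n - 1 - j.1 i) + 1 ↔ (j.1 i : ℕ) = e i % n := by
      exact fun i ↦ dvd_add_sub_iff_eq_mod (e i) (j.1 i).2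
    simp only [monomial_mul, mul_one, expandTrace_monomial, Finsupp.coe_add, Pi.add_apply, hE',
      key]
    split_ifs with h
    · rw [expand_monomial, monomial_mul, mul_one]
      congr 2
      ext i
      have hj := (j.1 i).2
      simp only [Finsupp.equivFunOnFinite_symm_apply_apply, Finsupp.coe_add, Pi.add_apply,
        Finsupp.coe_smul, Pi.smul_apply, smul_eq_mul, hE]
      have hi := h i
      have h₂ := Nat.div_add_mod (e i) n
      have : e i + (n - 1 - j.1 i) + 1 = n * (e i / n + 1) := by
        rw [mul_add]; omega
      rw [this, Nat.mul_div_cancel_left _ (by omega), Nat.add_sub_cancel]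
      omega
    · rw [map_zero, zero_mul]
  refine ⟨ι, inferInstance, inferInstance, τ, b, b', ⟨fun i j ↦ ?_, fun r ↦ ?_⟩⟩
  · have h : expandTrace F m n (monomial (E i.1) 1 * monomial (E' j.1) 1) =
        if i = j then 1 else 0 := by
      have key : ∀ k, n ∣ (i.1 k : ℕ) + (n - 1 - j.1 k) + 1 ↔ (j.1 k : ℕ) = i.1 k := fun k ↦ by
        rw [dvd_add_sub_iff_eq_mod _ (j.1 k).2, Nat.mod_eq_of_lt (i.1 k).2]
      simp only [monomial_mul, mul_one, expandTrace_monomial, Finsupp.coe_add, Pi.add_apply, hE,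
        hE', key]
      by_cases hij : i = j
      · subst hij
        rw [if_pos fun _ ↦ rfl, if_pos rfl, ← C_1, ← monomial_zero']
        congr 2
        ext k
        have := (i.1 k).2
        have h₁ : (i.1 k : ℕ) + (n - 1 - i.1 k) + 1 = n := by omega
        simp [h₁, Nat.div_self (Nat.pos_of_ne_zero hn)]
      · rw [if_neg hij, if_neg]
        exact fun h ↦ hij (Subtype.ext (funext fun k ↦ Fin.ext (h k).symm))
    exact h
  · apply Subtype.ext
    have h₀ : ((∑ j, τ (r * b' j) • b j : invariantAlg (Matrix.diagonal '' K)) :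
        MvPolynomial (Fin m) F) = ∑ j : ι, expand n (expandTrace F m n
          ((r : MvPolynomial (Fin m) F) * monomial (E' j.1) 1)) * monomial (E j.1) 1 := by
      rw [AddSubmonoidClass.coe_finsetSum]
      rfl
    rw [h₀]
    conv_lhs => rw [(r : MvPolynomial (Fin m) F).as_sum]
    conv_rhs => rw [(r : MvPolynomial (Fin m) F).as_sum]
    simp only [Finset.sum_mul, map_sum]
    rw [Finset.sum_comm]
    refine Finset.sum_congr rfl fun e he ↦ ?_
    simp only [hτ]
    let j₀ : Fin m → Fin n := fun i ↦ ⟨e i % n, Nat.mod_lt _ (Nat.pos_of_ne_zero hn)⟩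
    have hj₀ : ∀ d ∈ K, ∏ i, d i ^ (j₀ i : ℕ) = 1 := by
      intro d hd
      rw [← prod_pow_eq_one_of_mem_support K r.2 he hd]
      refine Finset.prod_congr rfl fun i _ ↦ ?_
      conv_rhs => rw [← Nat.div_add_mod (e i) n, pow_add, pow_mul, hK d hd, one_pow, one_mul]
    rw [Finset.sum_eq_single (⟨j₀, hj₀⟩ : ι)]
    · rw [if_pos fun i ↦ rfl]
    · intro j _ hj
      rw [if_neg]
      intro h
      exact hj (Subtype.ext (funext fun i ↦ Fin.ext (h i)))
    · simp

theorem isGorensteinRing_of_ringEquiv_invariantAlg_diagonal {n : ℕ} (hn : n ≠ 0)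
    (hK : ∀ d ∈ K, ∀ i, d i ^ n = 1) (hK₁ : ∀ d ∈ K, ∏ i, d i = 1) {R : Type u} [CommRing R]
    (e : invariantAlg (Matrix.diagonal '' K) ≃+* R) : IsGorensteinRing R := by
  let := (expandHom K hK).toRingHom.toAlgebra
  obtain ⟨ι, _, _, τ, b, b', h⟩ := exists_isDualPair_diagonal K hn hK hK₁
  have := h.isNoetherianRing
  have : IsNoetherianRing R := isNoetherianRing_of_ringEquiv _ e
  exact isGorensteinRing_of_hasInjectiveDimensionLE R m
    (hasInjectiveDimensionLE_self_of_ringEquiv e m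
      (h.hasInjectiveDimensionLE m (hasInjectiveDimensionLE_mvPolynomial_fin F m _)))

end DiagonalInvariants

section AdditivePolynomial

open scoped Polynomial

variable {D W : Type*} [CommRing D] [AddCommGroup W] [Fintype W] (φ : W →+ D)

/-- The monic polynomial with roots `-φ w`, for `w : W`. -/
def orbitPolynomial : D[X] := ∏ w, (Polynomial.X + Polynomial.C (φ w))

lemma orbitPolynomial_comp (v : W) :
    (orbitPolynomial φ).comp (Polynomial.X + Polynomial.C (φ v)) = orbitPolynomial φ := by
  rw [orbitPolynomial, Polynomial.prod_comp]
  refine Fintype.prod_equiv (Equiv.addLeft v) _ _ fun w ↦ ?_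
  simp [add_assoc]

lemma orbitPolynomial_monic : (orbitPolynomial φ).Monic :=
  Polynomial.monic_prod_of_monic _ _ fun _ _ ↦ Polynomial.monic_X_add_C _

variable [IsDomain D]

lemma natDegree_orbitPolynomial : (orbitPolynomial φ).natDegree = Fintype.card W := by
  rw [orbitPolynomial, Polynomial.natDegree_prod_of_monic _ _ fun _ _ ↦ Polynomial.monic_X_add_C _]
  simp

lemma comp_orbitPolynomial_injective :
    Function.Injective fun f : D[X] ↦ f.comp (orbitPolynomial φ) := by
  intro f g hfg
  have h : (f - g).comp (orbitPolynomial φ) = 0 := by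
    rw [Polynomial.sub_comp]; exact sub_eq_zero.2 hfg
  rcases Polynomial.comp_eq_zero_iff.1 h with h | ⟨-, h⟩
  · exact sub_eq_zero.1 h
  · have h₁ := natDegree_orbitPolynomial φ
    rw [h, Polynomial.natDegree_C] at h₁
    exact absurd h₁ Fintype.card_ne_zero.symm

lemma orbitPolynomial_dvd (hφ : Function.Injective φ) (g : D[X]) (hg : ∀ w, g.eval (φ w) = 0) :
    orbitPolynomial φ ∣ g := by
  rcases eq_or_ne g 0 with rfl | hg₀
  · exact dvd_zero _
  have h : orbitPolynomial φ =
      (((Finset.univ : Finset W).1.map fun w ↦ φ (-w)).map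
        fun a ↦ Polynomial.X - Polynomial.C a).prod := by
    rw [orbitPolynomial, Multiset.map_map, Finset.prod]
    congr 1
    exact Multiset.map_congr rfl fun w _ ↦ by simp
  rw [h, Multiset.prod_X_sub_C_dvd_iff_le_roots hg₀]
  refine (Multiset.le_iff_subset
    (Multiset.Nodup.map (hφ.comp neg_injective) Finset.univ.2)).2 fun a ha ↦ ?_
  obtain ⟨w, -, rfl⟩ := Multiset.mem_map.1 ha
  exact (Polynomial.mem_roots hg₀).2 (hg _)

theorem exists_eq_comp_orbitPolynomial (hφ : Function.Injective φ) (f : D[X])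
    (hf : ∀ w, f.comp (Polynomial.X + Polynomial.C (φ w)) = f) :
    ∃ h : D[X], f = h.comp (orbitPolynomial φ) := by
  induction hd : f.natDegree using Nat.strong_induction_on generalizing f with
  | _ d ih =>
    have hev : ∀ w, (f - Polynomial.C (f.eval 0)).eval (φ w) = 0 := fun w ↦ by
      have := congrArg (Polynomial.eval 0) (hf w)
      rw [Polynomial.eval_comp] at this
      simp only [Polynomial.eval_add, Polynomial.eval_X, Polynomial.eval_C, zero_add] at this
      rw [Polynomial.eval_sub, this, Polynomial.eval_C, sub_self]
    obtain ⟨q, hq⟩ := orbitPolynomial_dvd φ hφ _ hev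
    have hfq : f = Polynomial.C (f.eval 0) + orbitPolynomial φ * q := by rw [← hq]; ring
    rcases eq_or_ne q 0 with rfl | hq₀
    · exact ⟨Polynomial.C (f.eval 0), by rw [Polynomial.C_comp]; simpa using hfq⟩
    have hqinv : ∀ w, q.comp (Polynomial.X + Polynomial.C (φ w)) = q := fun w ↦ by
      have h := hf w
      rw [hfq] at h
      simp only [Polynomial.add_comp, Polynomial.mul_comp, Polynomial.C_comp,
        orbitPolynomial_comp] at h
      exact mul_left_cancel₀ (orbitPolynomial_monic φ).ne_zero (add_left_cancel h)
    have hdeg : q.natDegree < d := by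
      have h₁ : (f - Polynomial.C (f.eval 0)).natDegree = f.natDegree :=
        Polynomial.natDegree_sub_C
      rw [hq, Polynomial.natDegree_mul (orbitPolynomial_monic φ).ne_zero hq₀,
        natDegree_orbitPolynomial] at h₁
      have : 0 < Fintype.card W := Fintype.card_pos
      omega
    obtain ⟨h, rfl⟩ := ih _ hdeg q hqinv rfl
    exact ⟨Polynomial.C (f.eval 0) + Polynomial.X * h, by
      conv_lhs => rw [hfq]
      simp⟩

end AdditivePolynomial

section PolyAct

lemma polyAct_X {F : Type u} [CommSemiring F] {m : ℕ} (M : Matrix (Fin m) (Fin m) F) (i : Fin m) :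
    polyAct M (X i) = ∑ j, M i j • X j := by
  rw [polyAct, aeval_X]

lemma polyAct_polyAct {F : Type u} [CommSemiring F] {m : ℕ} (M N : Matrix (Fin m) (Fin m) F)
    (f : MvPolynomial (Fin m) F) : polyAct N (polyAct M f) = polyAct (M * N) f := by
  have : (polyAct N).comp (polyAct M) = polyAct (M * N) := by
    refine MvPolynomial.algHom_ext fun i ↦ ?_
    simp only [AlgHom.comp_apply, polyAct_X, map_sum, map_smul, Finset.smul_sum, Matrix.mul_apply,
      Finset.sum_smul, smul_smul]
    exact Finset.sum_comm
  exact DFunLike.congr_fun this f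

lemma polyAct_one {F : Type u} [CommSemiring F] {m : ℕ} (f : MvPolynomial (Fin m) F) :
    polyAct 1 f = f := by
  have : polyAct (1 : Matrix (Fin m) (Fin m) F) = AlgHom.id F _ := by
    refine MvPolynomial.algHom_ext fun i ↦ ?_
    simp [polyAct_X, Matrix.one_apply]
  rw [this, AlgHom.id_apply]

/-- Conjugate subgroups have isomorphic invariant rings. -/
def invariantRingConjEquiv {F : Type u} [Field F] {m : ℕ}
    (G : Subgroup (Matrix.SpecialLinearGroup (Fin m) F)) (Q : Matrix.SpecialLinearGroup (Fin m) F) :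
    invariantRing (G.map (MulAut.conj Q).toMonoidHom) ≃+* invariantRing G where
  toFun f := ⟨polyAct (Q : Matrix (Fin m) (Fin m) F) f.1, by
    rintro _ ⟨g, hg, rfl⟩
    have h := f.2 _ ⟨Q * g * Q⁻¹, ⟨g, hg, rfl⟩, rfl⟩
    conv_rhs => rw [← h]
    rw [polyAct_polyAct, polyAct_polyAct, ← Matrix.SpecialLinearGroup.coe_mul,
      ← Matrix.SpecialLinearGroup.coe_mul, inv_mul_cancel_right]⟩
  invFun f := ⟨polyAct (Q⁻¹ : Matrix.SpecialLinearGroup (Fin m) F).1 f.1, by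
    rintro _ ⟨_, ⟨g, hg, rfl⟩, rfl⟩
    have h := f.2 _ ⟨g, hg, rfl⟩
    conv_rhs => rw [← h]
    rw [polyAct_polyAct, polyAct_polyAct, ← Matrix.SpecialLinearGroup.coe_mul,
      ← Matrix.SpecialLinearGroup.coe_mul]
    simp [mul_assoc]⟩
  left_inv f := Subtype.ext <| by
    dsimp only
    rw [polyAct_polyAct, ← Matrix.SpecialLinearGroup.coe_mul, mul_inv_cancel,
      Matrix.SpecialLinearGroup.coe_one, polyAct_one]
  right_inv f := Subtype.ext <| by
    dsimp only
    rw [polyAct_polyAct, ← Matrix.SpecialLinearGroup.coe_mul, inv_mul_cancel,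
      Matrix.SpecialLinearGroup.coe_one, polyAct_one]
  map_mul' f g := Subtype.ext (map_mul _ _ _)
  map_add' f g := Subtype.ext (map_add _ _ _)

end PolyAct

section Shear

variable {F : Type u} [Field F]

/-- The unipotent matrix with first row `(1, w.1, w.2)` and the other rows standard. -/
def shearMatrix (w : F × F) : Matrix (Fin 3) (Fin 3) F := !![1, w.1, w.2; 0, 1, 0; 0, 0, 1]

/-- The linear form `w.1 • X 0 + w.2 • X 1`. -/
def pairForm (F : Type u) [Field F] : F × F →+ MvPolynomial (Fin 2) F where
  toFun w := C w.1 * X 0 + C w.2 * X 1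
  map_zero' := by simp
  map_add' v w := by simp only [Prod.fst_add, Prod.snd_add, C_add]; ring

lemma pairForm_apply (w : F × F) : pairForm F w = C w.1 * X 0 + C w.2 * X 1 := rfl

lemma pairForm_injective : Function.Injective (pairForm F) := by
  refine (injective_iff_map_eq_zero _).2 fun w hw ↦ ?_
  have h₁ := congrArg (MvPolynomial.eval ![1, 0]) hw
  have h₂ := congrArg (MvPolynomial.eval ![0, 1]) hw
  simp [pairForm_apply] at h₁ h₂
  exact Prod.ext h₁ h₂

lemma finSuccEquiv_C (n : ℕ) (r : F) : finSuccEquiv F n (C r) = Polynomial.C (C r) :=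
  (finSuccEquiv F n).commutes r

lemma finSuccEquiv_X_one : finSuccEquiv F 2 (X 1) = Polynomial.C (X 0) :=
  finSuccEquiv_X_succ (j := 0)

lemma finSuccEquiv_X_two : finSuccEquiv F 2 (X 2) = Polynomial.C (X 1) :=
  finSuccEquiv_X_succ (j := 1)

lemma ringHom_ext_fin_three {R : Type*} [CommSemiring R] {f g : MvPolynomial (Fin 3) F →+* R}
    (hC : ∀ r, f (C r) = g (C r)) (h₀ : f (X 0) = g (X 0)) (h₁ : f (X 1) = g (X 1))
    (h₂ : f (X 2) = g (X 2)) : f = g :=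
  MvPolynomial.ringHom_ext hC fun i ↦ by fin_cases i <;> assumption

lemma finSuccEquiv_polyAct_shearMatrix (w : F × F) (f : MvPolynomial (Fin 3) F) :
    finSuccEquiv F 2 (polyAct (shearMatrix w) f) =
      (finSuccEquiv F 2 f).comp (Polynomial.X + Polynomial.C (pairForm F w)) := by
  have : (finSuccEquiv F 2).toAlgHom.toRingHom.comp (polyAct (shearMatrix w)).toRingHom =
      (Polynomial.compRingHom (Polynomial.X + Polynomial.C (pairForm F w))).comp
        (finSuccEquiv F 2).toAlgHom.toRingHom := by
    apply ringHom_ext_fin_three <;>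
    simp [finSuccEquiv_C, finSuccEquiv_X_zero, finSuccEquiv_X_one, finSuccEquiv_X_two, polyAct_X,
      Fin.sum_univ_three, shearMatrix, pairForm_apply, smul_eq_C_mul, add_assoc]
  exact DFunLike.congr_fun this f

variable (W : AddSubgroup (F × F)) [Fintype W]

/-- The product of the orbit of `X 0` under the shears in `W`. -/
def shearNorm : MvPolynomial (Fin 3) F := ∏ w : W, (X 0 + (C w.1.1 * X 1 + C w.1.2 * X 2))

/-- The substitution `X 0 ↦ shearNorm W`. -/
def shearSubst : MvPolynomial (Fin 3) F →ₐ[F] MvPolynomial (Fin 3) F :=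
  aeval ![shearNorm W, X 1, X 2]

lemma shearSubst_X_zero : shearSubst W (X 0) = shearNorm W := by simp [shearSubst]

lemma shearSubst_X_one : shearSubst W (X 1) = X 1 := by simp [shearSubst]

lemma shearSubst_X_two : shearSubst W (X 2) = X 2 := by simp [shearSubst]

lemma finSuccEquiv_shearSubst (f : MvPolynomial (Fin 3) F) :
    finSuccEquiv F 2 (shearSubst W f) =
      (finSuccEquiv F 2 f).comp (orbitPolynomial ((pairForm F).comp W.subtype)) := by
  have : (finSuccEquiv F 2).toAlgHom.toRingHom.comp (shearSubst W).toRingHom =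
      (Polynomial.compRingHom (orbitPolynomial ((pairForm F).comp W.subtype))).comp
        (finSuccEquiv F 2).toAlgHom.toRingHom := by
    apply ringHom_ext_fin_three <;>
    simp [finSuccEquiv_C, finSuccEquiv_X_zero, finSuccEquiv_X_one, finSuccEquiv_X_two,
      shearSubst_X_zero, shearSubst_X_one, shearSubst_X_two, shearNorm,
      orbitPolynomial, pairForm_apply]
  exact DFunLike.congr_fun this f

lemma shearSubst_injective : Function.Injective (shearSubst W) := by
  intro f g h
  apply (finSuccEquiv F 2).injective
  apply comp_orbitPolynomial_injective ((pairForm F).comp W.subtype)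
  dsimp only
  rw [← finSuccEquiv_shearSubst, ← finSuccEquiv_shearSubst, h]

lemma exists_eq_shearSubst {f : MvPolynomial (Fin 3) F}
    (hf : ∀ w ∈ W, polyAct (shearMatrix w) f = f) : ∃ h, f = shearSubst W h := by
  obtain ⟨h, hh⟩ := exists_eq_comp_orbitPolynomial ((pairForm F).comp W.subtype)
    (pairForm_injective.comp Subtype.val_injective) (finSuccEquiv F 2 f) fun w ↦ by
      conv_rhs => rw [← hf w w.2, finSuccEquiv_polyAct_shearMatrix]
      rfl
  refine ⟨(finSuccEquiv F 2).symm h, (finSuccEquiv F 2).injective ?_⟩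
  rw [finSuccEquiv_shearSubst, AlgEquiv.apply_symm_apply, hh]

variable {W}

lemma polyAct_shearSubst {c a b s t : F} (hc : c ≠ 0) (hcW : c ^ Fintype.card W = c)
    (ha : a ≠ 0) (hb : b ≠ 0)
    (hW : ∀ w ∈ W, (c⁻¹ * (s + w.1 * a), c⁻¹ * (t + w.2 * b)) ∈ W) (h : MvPolynomial (Fin 3) F) :
    polyAct !![c, s, t; 0, a, 0; 0, 0, b] (shearSubst W h) =
      shearSubst W (polyAct (Matrix.diagonal ![c, a, b]) h) := by
  let σ : W → W := fun w ↦ ⟨_, hW w.1 w.2⟩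
  have hσ : Function.Injective σ := by
    intro v w hvw
    have h₁ := congrArg (fun w : W ↦ w.1.1) hvw
    have h₂ := congrArg (fun w : W ↦ w.1.2) hvw
    simp only [σ, mul_right_inj' (inv_ne_zero hc), add_right_inj, mul_left_inj' ha,
      mul_left_inj' hb] at h₁ h₂
    exact Subtype.ext (Prod.ext h₁ h₂)
  have hnorm : polyAct !![c, s, t; 0, a, 0; 0, 0, b] (shearNorm W) = C c * shearNorm W := by
    have : ∀ w : W, polyAct !![c, s, t; 0, a, 0; 0, 0, b]
        (X 0 + (C w.1.1 * X 1 + C w.1.2 * X 2)) =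
        C c * (X 0 + (C (σ w).1.1 * X 1 + C (σ w).1.2 * X 2)) := by
      intro w
      have h₁ : c * (σ w).1.1 = s + w.1.1 * a := mul_inv_cancel_left₀ hc _
      have h₂ : c * (σ w).1.2 = t + w.1.2 * b := mul_inv_cancel_left₀ hc _
      simp only [mul_add, ← mul_assoc, ← C_mul, h₁, h₂]
      simp [polyAct_X, Fin.sum_univ_three, smul_eq_C_mul]
      ring
    rw [shearNorm, map_prod, Finset.prod_congr rfl fun w _ ↦ this w, Finset.prod_mul_distrib,
      Finset.prod_const, Finset.card_univ, ← C_pow, hcW]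
    congr 1
    exact (Finite.injective_iff_bijective.1 hσ).prod_comp
      fun w : W ↦ (X 0 + (C w.1.1 * X 1 + C w.1.2 * X 2) : MvPolynomial (Fin 3) F)
  have : ((polyAct !![c, s, t; 0, a, 0; 0, 0, b]).comp (shearSubst W)).toRingHom =
      ((shearSubst W).comp (polyAct (Matrix.diagonal ![c, a, b]))).toRingHom := by
    apply ringHom_ext_fin_three <;>
    simp [shearSubst_X_zero, shearSubst_X_one, shearSubst_X_two, hnorm, polyAct_X,
      Fin.sum_univ_three, smul_eq_C_mul]
  exact DFunLike.congr_fun this h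

end Shear

section ShearGroup

open scoped MatrixGroups

variable {F : Type u} [Field F]

lemma shearMatrix_mul (v w : F × F) : shearMatrix v * shearMatrix w = shearMatrix (v + w) := by
  ext i j
  fin_cases i <;> fin_cases j <;> simp [shearMatrix, Matrix.mul_apply, Fin.sum_univ_three, add_comm]

lemma det_shearMatrix (w : F × F) : (shearMatrix w).det = 1 := by
  simp [shearMatrix, Matrix.det_fin_three]

lemma specialLinearGroup_mul_apply (g h : SpecialLinearGroup (Fin 3) F) (i j : Fin 3) :
    (g * h) i j = g i 0 * h 0 j + g i 1 * h 1 j + g i 2 * h 2 j := by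
  rw [Matrix.SpecialLinearGroup.coe_mul, Matrix.mul_apply, Fin.sum_univ_three]

/-- The shear matrix as an element of the special linear group. -/
def shear (w : F × F) : SpecialLinearGroup (Fin 3) F := ⟨shearMatrix w, det_shearMatrix w⟩

lemma shear_apply (w : F × F) (i j : Fin 3) : shear w i j = shearMatrix w i j := rfl

lemma shear_add (v w : F × F) : shear (v + w) = shear v * shear w :=
  Subtype.ext (shearMatrix_mul v w).symm

lemma shear_zero : shear (0 : F × F) = 1 := by
  ext i j
  fin_cases i <;> fin_cases j <;> simp [shear, shearMatrix]

lemma shear_neg (w : F × F) : shear (-w) = (shear w)⁻¹ :=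
  eq_inv_of_mul_eq_one_left (by rw [← shear_add, neg_add_cancel, shear_zero])

/-- The translation vectors of the shears lying in `G`. -/
def shearSubgroup (G : Subgroup (SpecialLinearGroup (Fin 3) F)) : AddSubgroup (F × F) where
  carrier := {w | shear w ∈ G}
  zero_mem' := by
    change shear 0 ∈ G
    rw [shear_zero]
    exact one_mem G
  add_mem' {v w} hv hw := by
    change shear (v + w) ∈ G
    rw [shear_add]
    exact mul_mem hv hw
  neg_mem' {w} hw := by
    change shear (-w) ∈ G
    rw [shear_neg]
    exact inv_mem hw

lemma mem_shearSubgroup {G : Subgroup (SpecialLinearGroup (Fin 3) F)} {w : F × F} :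
    w ∈ shearSubgroup G ↔ shear w ∈ G := Iff.rfl

/-- Matrices for which the last two coordinate vectors are (row) eigenvectors. -/
structure FixesLastLines (g : SpecialLinearGroup (Fin 3) F) : Prop where
  one_zero : g 1 0 = 0
  one_two : g 1 2 = 0
  two_zero : g 2 0 = 0
  two_one : g 2 1 = 0

namespace FixesLastLines

variable {g h : SpecialLinearGroup (Fin 3) F}

lemma coe_eq (hg : FixesLastLines g) : (g : Matrix (Fin 3) (Fin 3) F) =
    !![g 0 0, g 0 1, g 0 2; 0, g 1 1, 0; 0, 0, g 2 2] := by
  ext i j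
  fin_cases i <;> fin_cases j <;> simp [hg.one_zero, hg.one_two, hg.two_zero, hg.two_one]

lemma mul_diag (hg : FixesLastLines g) : g 0 0 * g 1 1 * g 2 2 = 1 := by
  have h := g.det_coe
  rw [hg.coe_eq, Matrix.det_fin_three] at h
  simpa using h

lemma zero_ne (hg : FixesLastLines g) : g 0 0 ≠ 0 := by
  have := hg.mul_diag
  rintro h
  simp [h] at this

lemma one_ne (hg : FixesLastLines g) : g 1 1 ≠ 0 := by
  have := hg.mul_diag
  rintro h
  simp [h] at this

lemma two_ne (hg : FixesLastLines g) : g 2 2 ≠ 0 := by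
  have := hg.mul_diag
  rintro h
  simp [h] at this

lemma mul_apply_self (hg : FixesLastLines g) (hh : FixesLastLines h) (i : Fin 3) :
    (g * h) i i = g i i * h i i := by
  rw [specialLinearGroup_mul_apply]
  fin_cases i <;> simp [hg.one_zero, hg.one_two, hg.two_zero, hg.two_one, hh.one_zero, hh.two_zero]

end FixesLastLines

/-- The normalised off-diagonal part of the first row. -/
def rowTail (g : SpecialLinearGroup (Fin 3) F) : F × F :=
  ((g 0 0)⁻¹ * g 0 1, (g 0 0)⁻¹ * g 0 2)

/-- The action of `g` on translation vectors of shears by conjugation. -/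
def tailMap (g : SpecialLinearGroup (Fin 3) F) : F × F →ₗ[F] F × F :=
  LinearMap.prodMap (((g 0 0)⁻¹ * g 1 1) • LinearMap.id) (((g 0 0)⁻¹ * g 2 2) • LinearMap.id)

lemma rowTail_shear (w : F × F) : rowTail (shear w) = w := by
  simp [rowTail, shear_apply, shearMatrix]

lemma tailMap_apply (g : SpecialLinearGroup (Fin 3) F) (w : F × F) :
    tailMap g w = ((g 0 0)⁻¹ * g 1 1 * w.1, (g 0 0)⁻¹ * g 2 2 * w.2) := rfl

lemma tailMap_shear (v w : F × F) : tailMap (shear v) w = w := by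
  simp [tailMap_apply, shear_apply, shearMatrix]

lemma fixesLastLines_shear (w : F × F) : FixesLastLines (shear w) := by
  constructor <;> rfl

namespace FixesLastLines

variable {g h : SpecialLinearGroup (Fin 3) F}

lemma mul (hg : FixesLastLines g) (hh : FixesLastLines h) : FixesLastLines (g * h) := by
  constructor <;> simp only [specialLinearGroup_mul_apply, hg.one_zero, hg.one_two, hg.two_zero,
    hg.two_one, hh.one_zero, hh.one_two, hh.two_zero, hh.two_one] <;> ring

lemma rowTail_mul (hg : FixesLastLines g) (hh : FixesLastLines h) :
    rowTail (g * h) = rowTail h + tailMap h (rowTail g) := by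
  have h₁ := hg.zero_ne
  have h₂ := hh.zero_ne
  rw [rowTail, tailMap_apply, rowTail, rowTail, hg.mul_apply_self hh, specialLinearGroup_mul_apply,
    specialLinearGroup_mul_apply, hh.two_one, hh.one_two]
  ext <;> simp <;> field_simp

lemma shear_mul (hg : FixesLastLines g) (w : F × F) :
    shear w * g = g * shear (tailMap g w) := by
  have h₁ := hg.zero_ne
  refine Matrix.SpecialLinearGroup.ext _ _ fun i j => ?_
  simp only [specialLinearGroup_mul_apply, shear_apply, tailMap_apply]
  fin_cases i <;> fin_cases j <;>
    simp [shearMatrix, hg.one_zero, hg.one_two, hg.two_zero, hg.two_one] <;> field_simp <;>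
    exact add_comm _ _

lemma eq_mul_shear (hg : FixesLastLines g) (hh : FixesLastLines h) (h₁ : g 1 1 = h 1 1)
    (h₂ : g 2 2 = h 2 2) : g = h * shear (rowTail g - rowTail h) := by
  have h₀ : g 0 0 = h 0 0 := by
    refine mul_right_cancel₀ (mul_ne_zero hh.one_ne hh.two_ne) ?_
    rw [← mul_assoc, ← mul_assoc, hh.mul_diag, ← h₁, ← h₂, hg.mul_diag]
  have h₃ := hh.zero_ne
  refine Matrix.SpecialLinearGroup.ext _ _ fun i j => ?_
  simp only [specialLinearGroup_mul_apply, shear_apply, rowTail]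
  fin_cases i <;> fin_cases j <;>
    simp [shearMatrix, h₀, h₁, h₂, h₃, mul_sub, hg.one_zero, hg.one_two, hg.two_zero, hg.two_one,
      hh.one_zero, hh.one_two, hh.two_zero, hh.two_one]

end FixesLastLines

end ShearGroup

section Averaging

open scoped MatrixGroups

section Field

variable {F : Type u} [Field F] {G : Subgroup SL(3, F)}

lemma FixesLastLines.tailMap_mem {g : SL(3, F)} (h : FixesLastLines g) (hg : g ∈ G)
    {w : F × F} (hw : w ∈ shearSubgroup G) : tailMap g w ∈ shearSubgroup G := by
  rw [mem_shearSubgroup, eq_inv_mul_of_mul_eq (h.shear_mul w).symm]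
  exact mul_mem (inv_mem hg) (mul_mem hw hg)

lemma rowTail_sub_mem (hG : ∀ g ∈ G, FixesLastLines g) {g h : SL(3, F)} (hg : g ∈ G) (hh : h ∈ G)
    (h₁ : g 1 1 = h 1 1) (h₂ : g 2 2 = h 2 2) : rowTail g - rowTail h ∈ shearSubgroup G := by
  rw [mem_shearSubgroup, eq_inv_mul_of_mul_eq ((hG g hg).eq_mul_shear (hG h hh) h₁ h₂).symm]
  exact mul_mem (inv_mem hh) hg

/-- The last two diagonal entries, as a multiplicative character. -/
def lastDiagHom (hG : ∀ g ∈ G, FixesLastLines g) : G →* (F × F)ˣ :=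
  MonoidHom.toHomUnits
    { toFun := fun g => (g.1 1 1, g.1 2 2)
      map_one' := by simp
      map_mul' := fun g h => by
        ext
        · exact (hG _ g.2).mul_apply_self (hG _ h.2) 1
        · exact (hG _ g.2).mul_apply_self (hG _ h.2) 2 }

lemma coe_lastDiagHom (hG : ∀ g ∈ G, FixesLastLines g) (g : G) :
    (lastDiagHom hG g : F × F) = (g.1 1 1, g.1 2 2) := rfl

end Field

variable {p : ℕ} [Fact p.Prime]

lemma natCast_card_subgroup_units_ne_zero (Δ : Subgroup (ZMod p × ZMod p)ˣ) [Fintype Δ] :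
    (Fintype.card Δ : ZMod p) ≠ 0 := by
  have hp : p.Prime := Fact.out
  rw [Ne, ZMod.natCast_eq_zero_iff, ← Nat.card_eq_fintype_card]
  intro h
  have h := h.trans Δ.card_subgroup_dvd_card
  rw [Nat.card_congr (MulEquiv.prodUnits (M := ZMod p) (N := ZMod p)).toEquiv, Nat.card_prod,
    Nat.card_eq_fintype_card, ZMod.card_units, hp.dvd_mul, or_self] at h
  have h₁ := hp.one_lt
  exact absurd (Nat.le_of_dvd (by lia) h) (by lia)

/-- The cocycle `rowTail` becomes a coboundary modulo the shears in `G`. -/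
theorem exists_rowTail_add_sub_mem {G : Subgroup SL(3, ZMod p)}
    (hG : ∀ g ∈ G, FixesLastLines g) :
    ∃ x, ∀ g ∈ G, rowTail g + tailMap g x - x ∈ shearSubgroup G := by
  classical
  let χ := lastDiagHom hG
  have := Fintype.ofFinite χ.range
  choose σ hσ using fun δ : χ.range => δ.2
  have hm := natCast_card_subgroup_units_ne_zero χ.range
  set m := (Fintype.card χ.range : ZMod p)
  refine ⟨m⁻¹ • ∑ δ, rowTail (σ δ).1, fun g hg => ?_⟩
  have key (δ : χ.range) : rowTail g + tailMap g (rowTail (σ δ).1) -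
      rowTail (σ (δ * χ.rangeRestrict ⟨g, hg⟩)).1 ∈ shearSubgroup G := by
    rw [← (hG _ (σ δ).2).rowTail_mul (hG g hg)]
    have h : χ (σ δ * ⟨g, hg⟩) = χ (σ (δ * χ.rangeRestrict ⟨g, hg⟩)) := by
      rw [hσ, map_mul, hσ]
      rfl
    have h := congrArg Units.val h
    rw [coe_lastDiagHom, coe_lastDiagHom, Prod.mk.injEq] at h
    exact rowTail_sub_mem hG (mul_mem (σ δ).2 hg) (σ _).2 h.1 h.2
  have hsum : ∑ δ, rowTail (σ (δ * χ.rangeRestrict ⟨g, hg⟩)).1 = ∑ δ, rowTail (σ δ).1 :=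
    Fintype.sum_equiv (Equiv.mulRight (χ.rangeRestrict ⟨g, hg⟩)) _ _ fun _ => rfl
  have h := ZMod.smul_mem (sum_mem fun δ (_ : δ ∈ Finset.univ) => key δ) m⁻¹
  convert h using 1
  rw [Finset.sum_sub_distrib, Finset.sum_add_distrib, Finset.sum_const, Finset.card_univ,
    hsum, ← map_sum,
    ← Nat.cast_smul_eq_nsmul (ZMod p), smul_sub, smul_add, inv_smul_smul₀ hm, map_smul]

end Averaging

section Gorenstein

open scoped MatrixGroups

variable {p : ℕ} [Fact p.Prime] {G : Subgroup SL(3, ZMod p)}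

lemma pow_card_addSubgroup_eq (W : AddSubgroup (ZMod p × ZMod p)) [Fintype W] (c : ZMod p) :
    c ^ Fintype.card W = c := by
  have h : Fintype.card W ∣ p ^ 2 := by
    rw [← Nat.card_eq_fintype_card]
    refine W.card_addSubgroup_dvd_card.trans ?_
    simp [sq]
  obtain ⟨k, -, hk⟩ := (Nat.dvd_prime_pow Fact.out).1 h
  rw [hk, ZMod.pow_card_pow]

lemma FixesLastLines.polyAct_shearSubst {g : SL(3, ZMod p)} (h : FixesLastLines g) (hg : g ∈ G)
    (hrow : rowTail g ∈ shearSubgroup G) [Fintype (shearSubgroup G)]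
    (f : MvPolynomial (Fin 3) (ZMod p)) :
    polyAct (g : Matrix (Fin 3) (Fin 3) (ZMod p)) (shearSubst (shearSubgroup G) f) =
      shearSubst (shearSubgroup G) (polyAct (Matrix.diagonal fun i => g i i) f) := by
  have hd : (fun i => g i i) = ![g 0 0, g 1 1, g 2 2] := by
    ext i
    fin_cases i <;> rfl
  rw [hd, h.coe_eq]
  refine _root_.polyAct_shearSubst h.zero_ne (pow_card_addSubgroup_eq _ _) h.one_ne h.two_ne
    (fun w hw => ?_) f
  convert add_mem hrow (h.tailMap_mem hg hw) using 1
  rw [rowTail, tailMap_apply]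
  ext <;> simp <;> ring

/-- If the cocycle `rowTail` is trivial modulo shears, invariants are obtained by substitution from
invariants of a diagonal group. -/
theorem exists_invariantAlg_diagonal_ringEquiv (hG : ∀ g ∈ G, FixesLastLines g)
    (hrow : ∀ g ∈ G, rowTail g ∈ shearSubgroup G) :
    Nonempty (invariantAlg (Matrix.diagonal '' ((fun g : SL(3, ZMod p) => fun i => g i i) '' G)) ≃+*
      invariantRing G) := by
  have := Fintype.ofFinite (shearSubgroup G)
  have key (f) (g) (hg : g ∈ G) := (hG g hg).polyAct_shearSubst hg (hrow g hg) f
  let φ : invariantAlg (Matrix.diagonal '' ((fun g : SL(3, ZMod p) => fun i => g i i) '' G)) →+*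
      invariantRing G :=
    ((shearSubst (shearSubgroup G)).toRingHom.comp (Subalgebra.val _).toRingHom).codRestrict _ <| by
      rintro ⟨f, hf⟩ M ⟨g, hg, rfl⟩
      refine (key f g hg).trans (congrArg _ ?_)
      exact hf _ ⟨_, ⟨g, hg, rfl⟩, rfl⟩
  refine ⟨RingEquiv.ofBijective φ ⟨fun f₁ f₂ h => ?_, ?_⟩⟩
  · exact Subtype.ext (shearSubst_injective _ (congrArg Subtype.val h))
  · rintro ⟨f, hf⟩
    obtain ⟨h, rfl⟩ := exists_eq_shearSubst (W := shearSubgroup G) (f := f) fun w hw =>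
      hf _ ⟨_, hw, rfl⟩
    refine ⟨⟨h, ?_⟩, rfl⟩
    rintro _ ⟨_, ⟨g, hg, rfl⟩, rfl⟩
    refine shearSubst_injective (shearSubgroup G) ?_
    rw [← key h g hg]
    exact hf _ ⟨g, hg, rfl⟩

theorem isGorensteinRing_of_rowTail_mem (hG : ∀ g ∈ G, FixesLastLines g)
    (hrow : ∀ g ∈ G, rowTail g ∈ shearSubgroup G) {R : Type} [CommRing R]
    (e : invariantRing G ≃+* R) : IsGorensteinRing R := by
  obtain ⟨e'⟩ := exists_invariantAlg_diagonal_ringEquiv hG hrow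
  refine isGorensteinRing_of_ringEquiv_invariantAlg_diagonal _ (n := p - 1) ?_ ?_ ?_ (e'.trans e)
  · exact Nat.sub_ne_zero_of_lt (Fact.out : p.Prime).one_lt
  · rintro _ ⟨g, hg, rfl⟩ i
    refine ZMod.pow_card_sub_one_eq_one ?_
    have h := hG g hg
    fin_cases i
    exacts [h.zero_ne, h.one_ne, h.two_ne]
  · rintro _ ⟨g, hg, rfl⟩
    rw [Fin.prod_univ_three, (hG g hg).mul_diag]

theorem isGorensteinRing_of_fixesLastLines (hG : ∀ g ∈ G, FixesLastLines g) {R : Type} [CommRing R]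
    (e : invariantRing G ≃+* R) : IsGorensteinRing R := by
  obtain ⟨x, hx⟩ := exists_rowTail_add_sub_mem hG
  have conj {g : SL(3, ZMod p)} (hg : g ∈ G) :
      MulAut.conj (shear x) g = g * shear (tailMap g x - x) := by
    rw [MulAut.conj_apply, (hG g hg).shear_mul, mul_assoc, ← shear_neg, ← shear_add,
      sub_eq_add_neg]
  refine isGorensteinRing_of_rowTail_mem (G := G.map (MulAut.conj (shear x)).toMonoidHom) ?_ ?_
    ((invariantRingConjEquiv G (shear x)).trans e)
  · rintro _ ⟨g, hg, rfl⟩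
    change FixesLastLines (MulAut.conj (shear x) g)
    rw [conj hg]
    exact (hG g hg).mul (fixesLastLines_shear _)
  · rintro _ ⟨g, hg, rfl⟩
    change rowTail (MulAut.conj (shear x) g) ∈ _
    rw [conj hg, (hG g hg).rowTail_mul (fixesLastLines_shear _), rowTail_shear, tailMap_shear,
      add_comm, ← add_sub_assoc]
    refine ⟨_, hx g hg, ?_⟩
    change shear x * shear _ * (shear x)⁻¹ = _
    rw [← shear_add, ← shear_neg, ← shear_add, add_neg_cancel_comm]

lemma conj_apply_eq_zero {F : Type u} [Field F] {m : ℕ}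
    {Q g : Matrix.SpecialLinearGroup (Fin m) F} {i j : Fin m} (hij : i ≠ j)
    (h : Q i ᵥ* (g : Matrix (Fin m) (Fin m) F) ∈ Submodule.span F {Q i}) :
    (MulAut.conj Q g) i j = 0 := by
  obtain ⟨c, hc⟩ := Submodule.mem_span_singleton.1 h
  have h₁ : (MulAut.conj Q g) i = c • (Q * Q⁻¹) i := by
    rw [MulAut.conj_apply, Matrix.SpecialLinearGroup.coe_mul, Matrix.SpecialLinearGroup.coe_mul,
      Matrix.SpecialLinearGroup.coe_mul, Matrix.mul_apply_eq_vecMul, Matrix.mul_apply_eq_vecMul,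
      Matrix.mul_apply_eq_vecMul, ← hc, Matrix.smul_vecMul]
  rw [h₁, mul_inv_cancel, Matrix.SpecialLinearGroup.coe_one, Pi.smul_apply,
    Matrix.one_apply_ne hij, smul_zero]

lemma exists_specialLinearGroup_rows {F : Type u} [Field F] {v w : Fin 3 → F}
    (h : LinearIndependent F ![v, w]) : ∃ Q : SL(3, F), Q 1 = v ∧ Q 2 = w := by
  obtain ⟨i, hi⟩ := Function.ne_iff.1 (crossProduct_ne_zero_iff_linearIndependent.2 h)
  refine ⟨⟨![Pi.single i ((crossProduct v w) i)⁻¹, v, w], ?_⟩, rfl, rfl⟩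
  rw [← triple_product_eq_det, single_dotProduct, inv_mul_cancel₀ hi]

end Gorenstein

/-- If `G ⊆ SL(3, 𝔽_p)` and `V = 𝔽_p³` contains two distinct
1-dimensional `G`-submodules, then `S(V)^G` is Gorenstein. -/
theorem stmt19 (p : ℕ) [Fact p.Prime]
    (G : Subgroup (Matrix.SpecialLinearGroup (Fin 3) (ZMod p)))
    (w₁ w₂ : Fin 3 → ZMod p) (hw₁ : w₁ ≠ 0) (hw₂ : w₂ ≠ 0)
    (hne : Submodule.span (ZMod p) ({w₁} : Set (Fin 3 → ZMod p)) ≠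
      Submodule.span (ZMod p) ({w₂} : Set (Fin 3 → ZMod p)))
    (hG₁ : ∀ g ∈ G, w₁ ᵥ* (g : Matrix (Fin 3) (Fin 3) (ZMod p)) ∈
      Submodule.span (ZMod p) ({w₁} : Set (Fin 3 → ZMod p)))
    (hG₂ : ∀ g ∈ G, w₂ ᵥ* (g : Matrix (Fin 3) (Fin 3) (ZMod p)) ∈
      Submodule.span (ZMod p) ({w₂} : Set (Fin 3 → ZMod p))) :
    IsGorensteinRing ↥(invariantRing G) := by
  have hli : LinearIndependent (ZMod p) ![w₁, w₂] := by
    refine (LinearIndependent.pair_iff' hw₁).2 fun a ha => hne ?_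
    have h₀ : a ≠ 0 := by
      rintro rfl
      exact hw₂ (by rw [← ha, zero_smul])
    rw [← ha, Submodule.span_singleton_smul_eq h₀.isUnit]
  obtain ⟨Q, rfl, rfl⟩ := exists_specialLinearGroup_rows hli
  refine isGorensteinRing_of_fixesLastLines (G := G.map (MulAut.conj Q).toMonoidHom) ?_
    (invariantRingConjEquiv G Q)
  rintro _ ⟨g, hg, rfl⟩
  exact ⟨conj_apply_eq_zero (by decide) (hG₁ g hg), conj_apply_eq_zero (by decide) (hG₁ g hg),
    conj_apply_eq_zero (by decide) (hG₂ g hg), conj_apply_eq_zero (by decide) (hG₂ g hg)⟩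

end
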